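/- For n ≥ 2, every element of the reduced type-B Birman–Murakami–Wenzl algebra BB_n(R) is an R-linear combination of elements of the form w₁·γ·w₂, where w₁ and w₂ lie in the image of the canonical R-algebra homomorphism BB_{n−1}(R) → BB_n(R) (sending each generator to the like-named generator) and γ ∈ {1, e_{n−1}, X_{n−1}, Y_n}. -/

import Mathlib

namespace BMWB

inductive Gen (n : ℕ) : Type
  | X : Fin (n - 1) → Gen n
  | Xinv : Fin (n - 1) → Gen n
  | Y : 0 < n → Gen n
  | Yinv : 0 < n → Gen n

variable (R : Type) [CommRing R]

def fX {n : ℕ} (i : Fin (n - 1)) : FreeAlgebra R (Gen n) := FreeAlgebra.ι R (Gen.X i)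
def fXinv {n : ℕ} (i : Fin (n - 1)) : FreeAlgebra R (Gen n) := FreeAlgebra.ι R (Gen.Xinv i)
def fY {n : ℕ} (h : 0 < n) : FreeAlgebra R (Gen n) := FreeAlgebra.ι R (Gen.Y h)
def fYinv {n : ℕ} (h : 0 < n) : FreeAlgebra R (Gen n) := FreeAlgebra.ι R (Gen.Yinv h)
def fe {n : ℕ} (deli : R) (i : Fin (n - 1)) : FreeAlgebra R (Gen n) :=
  1 - deli • (fX R i - fXinv R i)

variable (lam lami deli q0 q1 A : R) (n : ℕ)

/-- The defining relations of the reduced Birman-Murakami-Wenzl algebra of Coxeter type B. -/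
inductive Rel : FreeAlgebra R (Gen n) → FreeAlgebra R (Gen n) → Prop
  | XXinv (i : Fin (n - 1)) : Rel (fX R i * fXinv R i) 1
  | XinvX (i : Fin (n - 1)) : Rel (fXinv R i * fX R i) 1
  | YYinv (h : 0 < n) : Rel (fY R h * fYinv R h) 1
  | YinvY (h : 0 < n) : Rel (fYinv R h * fY R h) 1
  | comm (i j : Fin (n - 1)) (h : (j : ℕ) + 1 < (i : ℕ)) :
      Rel (fX R i * fX R j) (fX R j * fX R i)
  | braid (i j : Fin (n - 1)) (h : (i : ℕ) + 1 = (j : ℕ)) :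
      Rel (fX R i * fX R j * fX R i) (fX R j * fX R i * fX R j)
  | Xe (i : Fin (n - 1)) : Rel (fX R i * fe R deli i) (lam • fe R deli i)
  | eX (i : Fin (n - 1)) : Rel (fe R deli i * fX R i) (lam • fe R deli i)
  | eXe (i j : Fin (n - 1)) (h : (j : ℕ) + 1 = (i : ℕ)) :
      Rel (fe R deli i * fX R j * fe R deli i) (lami • fe R deli i)
  | eXinve (i j : Fin (n - 1)) (h : (j : ℕ) + 1 = (i : ℕ)) :
      Rel (fe R deli i * fXinv R j * fe R deli i) (lam • fe R deli i)
  | bYXYX (h : 0 < n) (i : Fin (n - 1)) (hi : (i : ℕ) = 0) :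
      Rel (fX R i * fY R h * fX R i * fY R h) (fY R h * fX R i * fY R h * fX R i)
  | Ysq (h : 0 < n) : Rel (fY R h * fY R h) (q1 • fY R h + q0 • (1 : FreeAlgebra R (Gen n)))
  | YXYe (h : 0 < n) (i : Fin (n - 1)) (hi : (i : ℕ) = 0) :
      Rel (fY R h * fX R i * fY R h * fe R deli i) (fe R deli i)
  | Ycomm (h : 0 < n) (i : Fin (n - 1)) (hi : 0 < (i : ℕ)) :
      Rel (fY R h * fX R i) (fX R i * fY R h)
  | eYe (h : 0 < n) (i : Fin (n - 1)) (hi : (i : ℕ) = 0) :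
      Rel (fe R deli i * fY R h * fe R deli i) (A • fe R deli i)

/-- The reduced Birman-Murakami-Wenzl algebra of Coxeter type B, `BB_n(R)`,
presented by generators and relations. -/
abbrev BB : Type := RingQuot (Rel R lam lami deli q0 q1 A n)

noncomputable def mk : FreeAlgebra R (Gen n) →ₐ[R] BB R lam lami deli q0 q1 A n :=
  RingQuot.mkAlgHom R (Rel R lam lami deli q0 q1 A n)

/-- The generator `Y` (junk value `1` if `n = 0`). -/
noncomputable def YY : BB R lam lami deli q0 q1 A n :=
  if h : 0 < n then mk R lam lami deli q0 q1 A n (fY R h) else 1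

/-- The inverse of the generator `Y`. -/
noncomputable def YYi : BB R lam lami deli q0 q1 A n :=
  if h : 0 < n then mk R lam lami deli q0 q1 A n (fYinv R h) else 1

/-- The generator `X_i`, `1 ≤ i ≤ n-1` (junk value `1` out of range). -/
noncomputable def XX (i : ℕ) : BB R lam lami deli q0 q1 A n :=
  if h : i - 1 < n - 1 then mk R lam lami deli q0 q1 A n (fX R ⟨i - 1, h⟩) else 1

/-- The inverse `X_i⁻¹`. -/
noncomputable def XXi (i : ℕ) : BB R lam lami deli q0 q1 A n :=
  if h : i - 1 < n - 1 then mk R lam lami deli q0 q1 A n (fXinv R ⟨i - 1, h⟩) else 1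

/-- The element `e_i := 1 - δ⁻¹ (X_i - X_i⁻¹)`. -/
noncomputable def ee (i : ℕ) : BB R lam lami deli q0 q1 A n :=
  1 - deli • (XX R lam lami deli q0 q1 A n i - XXi R lam lami deli q0 q1 A n i)

/-- `Y_i := X_{i-1} ⋯ X_1 Y X_1⁻¹ ⋯ X_{i-1}⁻¹`. -/
noncomputable def Yn : ℕ → BB R lam lami deli q0 q1 A n
  | 0 => 1
  | 1 => YY R lam lami deli q0 q1 A n
  | (k + 2) => XX R lam lami deli q0 q1 A n (k + 1) * Yn (k + 1) * XXi R lam lami deli q0 q1 A n (k + 1)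

/-- `Y'_i := X_{i-1} ⋯ X_1 Y X_1 ⋯ X_{i-1}`. -/
noncomputable def Yp : ℕ → BB R lam lami deli q0 q1 A n
  | 0 => 1
  | 1 => YY R lam lami deli q0 q1 A n
  | (k + 2) => XX R lam lami deli q0 q1 A n (k + 1) * Yp (k + 1) * XX R lam lami deli q0 q1 A n (k + 1)

/-- The inverse of `Y'_i`. -/
noncomputable def Ypi : ℕ → BB R lam lami deli q0 q1 A n
  | 0 => 1
  | 1 => YYi R lam lami deli q0 q1 A n
  | (k + 2) => XXi R lam lami deli q0 q1 A n (k + 1) * Ypi (k + 1) * XXi R lam lami deli q0 q1 A n (k + 1)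

/-- The set of the images of the generators (and their inverses) of `BB_{m+1}` inside `BB_n`.
Its `Algebra.adjoin` is the image of the canonical algebra homomorphism `BB_{m+1} → BB_n`. -/
noncomputable def genSet (m : ℕ) : Set (BB R lam lami deli q0 q1 A n) :=
  {a | a = YY R lam lami deli q0 q1 A n ∨ a = YYi R lam lami deli q0 q1 A n ∨
    ∃ i, 1 ≤ i ∧ i ≤ m ∧ (a = XX R lam lami deli q0 q1 A n i ∨ a = XXi R lam lami deli q0 q1 A n i)}

/-- The image of the canonical algebra homomorphism `BB_{m+1}(R) → BB_n(R)`, realized as the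
subalgebra generated by the images of the generators `Y, Y⁻¹, X_1, …, X_m` (and inverses). -/
noncomputable def sub (m : ℕ) : Subalgebra R (BB R lam lami deli q0 q1 A n) :=
  Algebra.adjoin R (genSet R lam lami deli q0 q1 A n m)

/-- `X(i,j) = X_i X_{i+1} ⋯ X_j`. -/
noncomputable def Xprod (i j : ℕ) : BB R lam lami deli q0 q1 A n :=
  ((List.range (j + 1 - i)).map (fun k => XX R lam lami deli q0 q1 A n (i + k))).prod

/-- `E(i,j) = e_i e_{i+2} ⋯ e_j`. -/
noncomputable def Eprod (i j : ℕ) : BB R lam lami deli q0 q1 A n :=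
  ((List.range ((j - i) / 2 + 1)).map (fun k => ee R lam lami deli q0 q1 A n (i + 2 * k))).prod

/-- `H_1 = e_1`, `H_{m+1} = e_{m+1} X(m+2, 2m+1) X(m+1, 2m) H_m`. -/
noncomputable def H : ℕ → BB R lam lami deli q0 q1 A n
  | 0 => 1
  | 1 => ee R lam lami deli q0 q1 A n 1
  | (k + 2) => ee R lam lami deli q0 q1 A n (k + 2) *
      Xprod R lam lami deli q0 q1 A n (k + 3) (2 * k + 3) *
      Xprod R lam lami deli q0 q1 A n (k + 2) (2 * k + 2) * H (k + 1)

section Generic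

variable {R} {M : Type} [Ring M] [Algebra R M]

theorem semiconjBy_inverse {u a b ai bi : M} (h : SemiconjBy u a b) (ha : a * ai = 1)
    (hb : bi * b = 1) : SemiconjBy u ai bi := by
  have h' : u * a = b * u := h
  calc u * ai = bi * b * u * ai := by rw [hb, one_mul]
    _ = bi * (u * a) * ai := by rw [h']; noncomm_ring
    _ = bi * u * (a * ai) := by noncomm_ring
    _ = bi * u := by rw [ha, mul_one]

theorem semiconjBy_idem {u a b ai bi : M} (deli : R) (h : SemiconjBy u a b)
    (h' : SemiconjBy u ai bi) : SemiconjBy u (1 - deli • (a - ai)) (1 - deli • (b - bi)) := by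
  have h1 : u * a = b * u := h
  have h2 : u * ai = bi * u := h'
  change u * _ = _ * u
  rw [mul_sub, sub_mul, mul_smul_comm, smul_mul_assoc, mul_sub, sub_mul, h1, h2, mul_one, one_mul]

/-- If `a * b` conjugates `e` to `f`, then `a * b * e = f * e`, given the partial trace of `b⁻¹`. -/
theorem mul_mul_idem_eq {a b bi e f : M} {lam lami : R} (hlam : lam * lami = 1) (hb : b * bi = 1)
    (hs : SemiconjBy (a * b) e f) (hae : a * e = lam • e) (hebe : e * bi * e = lam • e) :
    a * b * e = f * e := by
  have hs' : a * b * e = f * (a * b) := hs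
  have key : lam • (a * b * e) = lam • (f * e) := by
    calc lam • (a * b * e) = a * b * (e * bi * e) := by rw [hebe, mul_smul_comm]
      _ = (a * b * e) * bi * e := by noncomm_ring
      _ = f * a * (b * bi) * e := by rw [hs']; noncomm_ring
      _ = f * (a * e) := by rw [hb]; noncomm_ring
      _ = lam • (f * e) := by rw [hae, mul_smul_comm]
  have := congrArg (lami • ·) key
  simpa only [smul_smul, mul_comm lami, hlam, one_smul] using this

/-- The span of the products `w₁ * γ * w₂` with `w₁, w₂ ∈ B` and `γ ∈ G`. -/
def bimoduleSpan (B : Subalgebra R M) (G : Set M) : Submodule R M :=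
  Submodule.span R {w | ∃ w1 ∈ B, ∃ w2 ∈ B, ∃ γ ∈ G, w = w1 * γ * w2}

variable {B : Subalgebra R M} {G : Set M}

theorem subset_bimoduleSpan {g : M} (hg : g ∈ G) : g ∈ bimoduleSpan B G :=
  Submodule.subset_span ⟨1, B.one_mem, 1, B.one_mem, g, hg, by simp⟩

theorem map_mem_of_mem_bimoduleSpan (f : M →ₗ[R] M) (V : Submodule R M)
    (h : ∀ w1 ∈ B, ∀ w2 ∈ B, ∀ g ∈ G, f (w1 * g * w2) ∈ V) {s : M} (hs : s ∈ bimoduleSpan B G) :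
    f s ∈ V := by
  have : bimoduleSpan B G ≤ V.comap f := by
    refine Submodule.span_le.2 ?_
    rintro _ ⟨w1, h1, w2, h2, g, hg, rfl⟩
    exact h w1 h1 w2 h2 g hg
  exact this hs

theorem mul_mul_mem_bimoduleSpan {w1 w2 g : M} (h1 : w1 ∈ B) (hg : g ∈ G) (h2 : w2 ∈ B) :
    w1 * g * w2 ∈ bimoduleSpan B G :=
  Submodule.subset_span ⟨w1, h1, w2, h2, g, hg, rfl⟩

theorem mul_mem_bimoduleSpan {b s : M} (hb : b ∈ B) (hs : s ∈ bimoduleSpan B G) :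
    b * s ∈ bimoduleSpan B G :=
  map_mem_of_mem_bimoduleSpan (LinearMap.mulLeft R b) _ (fun w1 h1 w2 h2 g hg => by
    simpa [mul_assoc] using mul_mul_mem_bimoduleSpan (B.mul_mem hb h1) hg h2) hs

theorem bimoduleSpan_mul_mem {b s : M} (hb : b ∈ B) (hs : s ∈ bimoduleSpan B G) :
    s * b ∈ bimoduleSpan B G :=
  map_mem_of_mem_bimoduleSpan (LinearMap.mulRight R b) _ (fun w1 h1 w2 h2 g hg => by
    simpa [mul_assoc] using mul_mul_mem_bimoduleSpan h1 hg (B.mul_mem h2 hb)) hs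

theorem bimoduleSpan_le {G' : Set M} (h : ∀ g ∈ G, g ∈ bimoduleSpan B G') :
    bimoduleSpan B G ≤ bimoduleSpan B G' := fun _ hs =>
  map_mem_of_mem_bimoduleSpan LinearMap.id _ (fun _ h1 _ h2 g hg =>
    bimoduleSpan_mul_mem h2 (mul_mem_bimoduleSpan h1 (h g hg))) hs

theorem adjoin_le_of_mul_mem {s : Set M} {V : Submodule R M} (h1 : (1 : M) ∈ V)
    (h : ∀ g ∈ s, ∀ v ∈ V, g * v ∈ V) {a : M} (ha : a ∈ Algebra.adjoin R s) : a ∈ V := by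
  have key : ∀ v ∈ V, a * v ∈ V := by
    induction ha using Algebra.adjoin_induction with
    | mem g hg => exact h g hg
    | algebraMap r =>
      intro v hv
      rw [← Algebra.smul_def]
      exact V.smul_mem r hv
    | add a b _ _ iha ihb =>
      intro v hv
      rw [add_mul]
      exact V.add_mem (iha v hv) (ihb v hv)
    | mul a b _ _ iha ihb =>
      intro v hv
      rw [mul_assoc]
      exact iha _ (ihb v hv)
  simpa using key 1 h1

end Generic

section Relations

variable {R lam lami deli q0 q1 A n}

local notation "𝐌" => BB R lam lami deli q0 q1 A n
local notation "𝐗" => XX R lam lami deli q0 q1 A n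
local notation "𝐗⁻" => XXi R lam lami deli q0 q1 A n
local notation "𝐞" => ee R lam lami deli q0 q1 A n
local notation "𝐘" => YY R lam lami deli q0 q1 A n
local notation "𝐘⁻" => YYi R lam lami deli q0 q1 A n
local notation "𝐘𝐩" => Yp R lam lami deli q0 q1 A n
local notation "𝐘𝐩⁻" => Ypi R lam lami deli q0 q1 A n
local notation "𝐘𝐧" => Yn R lam lami deli q0 q1 A n
local notation "𝐁" => sub R lam lami deli q0 q1 A n

theorem mk_eq_of_rel {a b : FreeAlgebra R (Gen n)} (h : Rel R lam lami deli q0 q1 A n a b) :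
    mk R lam lami deli q0 q1 A n a = mk R lam lami deli q0 q1 A n b :=
  RingQuot.mkAlgHom_rel R h

theorem XX_succ {i : ℕ} (h : i < n - 1) :
    𝐗 (i + 1) = mk R lam lami deli q0 q1 A n (fX R ⟨i, h⟩) := by
  simp [XX, h]

theorem XXi_succ {i : ℕ} (h : i < n - 1) :
    𝐗⁻ (i + 1) = mk R lam lami deli q0 q1 A n (fXinv R ⟨i, h⟩) := by
  simp [XXi, h]

theorem ee_succ {i : ℕ} (h : i < n - 1) :
    𝐞 (i + 1) = mk R lam lami deli q0 q1 A n (fe R deli ⟨i, h⟩) := by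
  simp [ee, fe, XX_succ h, XXi_succ h]

theorem ee_def (i : ℕ) : 𝐞 i = 1 - deli • (𝐗 i - 𝐗⁻ i) := rfl

theorem YY_eq (h : 0 < n) : 𝐘 = mk R lam lami deli q0 q1 A n (fY R h) := by
  simp [YY, h]

theorem YYi_eq (h : 0 < n) : 𝐘⁻ = mk R lam lami deli q0 q1 A n (fYinv R h) := by
  simp [YYi, h]

theorem XX_mul_XXi {i : ℕ} (h : i < n - 1) : 𝐗 (i + 1) * 𝐗⁻ (i + 1) = 1 := by
  rw [XX_succ h, XXi_succ h, ← map_mul, mk_eq_of_rel (.XXinv _), map_one]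

theorem XXi_mul_XX {i : ℕ} (h : i < n - 1) : 𝐗⁻ (i + 1) * 𝐗 (i + 1) = 1 := by
  rw [XX_succ h, XXi_succ h, ← map_mul, mk_eq_of_rel (.XinvX _), map_one]

theorem YY_mul_YYi (h : 0 < n) : 𝐘 * 𝐘⁻ = 1 := by
  rw [YY_eq h, YYi_eq h, ← map_mul, mk_eq_of_rel (.YYinv _), map_one]

theorem YYi_mul_YY (h : 0 < n) : 𝐘⁻ * 𝐘 = 1 := by
  rw [YY_eq h, YYi_eq h, ← map_mul, mk_eq_of_rel (.YinvY _), map_one]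

theorem XX_commute {i j : ℕ} (h : i < n - 1) (hji : j + 1 < i) :
    Commute (𝐗 (i + 1)) (𝐗 (j + 1)) := by
  have hj : j < n - 1 := by omega
  change _ * _ = _ * _
  rw [XX_succ h, XX_succ hj, ← map_mul, mk_eq_of_rel (.comm _ _ hji), map_mul]

theorem XX_braid {i : ℕ} (h : i + 1 < n - 1) :
    𝐗 (i + 1) * 𝐗 (i + 2) * 𝐗 (i + 1) = 𝐗 (i + 2) * 𝐗 (i + 1) * 𝐗 (i + 2) := by
  have hi : i < n - 1 := by omega
  rw [XX_succ h, XX_succ hi]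
  simp only [← map_mul]
  exact mk_eq_of_rel (.braid _ _ rfl)

theorem XX_mul_ee {i : ℕ} (h : i < n - 1) : 𝐗 (i + 1) * 𝐞 (i + 1) = lam • 𝐞 (i + 1) := by
  rw [XX_succ h, ee_succ h, ← map_mul, mk_eq_of_rel (.Xe _), map_smul]

theorem ee_mul_XX {i : ℕ} (h : i < n - 1) : 𝐞 (i + 1) * 𝐗 (i + 1) = lam • 𝐞 (i + 1) := by
  rw [XX_succ h, ee_succ h, ← map_mul, mk_eq_of_rel (.eX _), map_smul]

theorem ee_XX_ee {i : ℕ} (h : i + 1 < n - 1) :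
    𝐞 (i + 2) * 𝐗 (i + 1) * 𝐞 (i + 2) = lami • 𝐞 (i + 2) := by
  have hi : i < n - 1 := by omega
  rw [ee_succ h, XX_succ hi, ← map_mul, ← map_mul, mk_eq_of_rel (.eXe _ _ rfl), map_smul]

theorem ee_XXi_ee {i : ℕ} (h : i + 1 < n - 1) :
    𝐞 (i + 2) * 𝐗⁻ (i + 1) * 𝐞 (i + 2) = lam • 𝐞 (i + 2) := by
  have hi : i < n - 1 := by omega
  rw [ee_succ h, XXi_succ hi, ← map_mul, ← map_mul, mk_eq_of_rel (.eXinve _ _ rfl), map_smul]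

theorem XYXY (h : 0 < n - 1) : 𝐗 1 * 𝐘 * 𝐗 1 * 𝐘 = 𝐘 * 𝐗 1 * 𝐘 * 𝐗 1 := by
  have h0 : 0 < n := by omega
  rw [XX_succ h, YY_eq h0]
  simp only [← map_mul]
  exact mk_eq_of_rel (.bYXYX h0 _ rfl)

theorem YY_sq (h : 0 < n) : 𝐘 * 𝐘 = q1 • 𝐘 + q0 • (1 : 𝐌) := by
  rw [YY_eq h, ← map_mul, mk_eq_of_rel (.Ysq h), map_add, map_smul, map_smul, map_one]

theorem YXY_ee (h : 0 < n - 1) : 𝐘 * 𝐗 1 * 𝐘 * 𝐞 1 = 𝐞 1 := by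
  have h0 : 0 < n := by omega
  rw [XX_succ h, YY_eq h0, ee_succ h]
  simp only [← map_mul]
  exact mk_eq_of_rel (.YXYe h0 _ rfl)

theorem YY_commute_XX {i : ℕ} (h : i + 1 < n - 1) : Commute 𝐘 (𝐗 (i + 2)) := by
  have h0 : 0 < n := by omega
  change _ * _ = _ * _
  rw [XX_succ h, YY_eq h0, ← map_mul, mk_eq_of_rel (.Ycomm h0 _ (by simp)), map_mul]

theorem commute_XXi {u : 𝐌} {i : ℕ} (h : i < n - 1) (hu : Commute u (𝐗 (i + 1))) :
    Commute u (𝐗⁻ (i + 1)) :=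
  semiconjBy_inverse hu (XX_mul_XXi h) (XXi_mul_XX h)

theorem commute_YYi {u : 𝐌} (h : 0 < n) (hu : Commute u 𝐘) : Commute u 𝐘⁻ :=
  semiconjBy_inverse hu (YY_mul_YYi h) (YYi_mul_YY h)

theorem commute_ee {u : 𝐌} {i : ℕ} (h : i < n - 1) (hu : Commute u (𝐗 (i + 1))) :
    Commute u (𝐞 (i + 1)) :=
  semiconjBy_idem deli hu (commute_XXi h hu)

theorem semiconjBy_ee {u : 𝐌} {i j : ℕ} (hi : i < n - 1) (hj : j < n - 1)
    (h : SemiconjBy u (𝐗 (i + 1)) (𝐗 (j + 1))) : SemiconjBy u (𝐞 (i + 1)) (𝐞 (j + 1)) :=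
  semiconjBy_idem deli h (semiconjBy_inverse h (XX_mul_XXi hi) (XXi_mul_XX hj))

theorem semiconjBy_up {i : ℕ} (h : i + 1 < n - 1) :
    SemiconjBy (𝐗 (i + 1) * 𝐗 (i + 2)) (𝐞 (i + 1)) (𝐞 (i + 2)) :=
  semiconjBy_ee (by omega) h (by
    change _ * _ = _ * _
    rw [XX_braid h, mul_assoc])

theorem semiconjBy_down {i : ℕ} (h : i + 1 < n - 1) :
    SemiconjBy (𝐗 (i + 2) * 𝐗 (i + 1)) (𝐞 (i + 2)) (𝐞 (i + 1)) :=
  semiconjBy_ee h (by omega) (by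
    change _ * _ = _ * _
    rw [← XX_braid h, mul_assoc])

theorem ee_XXi_ee' {i : ℕ} (h : i + 1 < n - 1) :
    𝐞 (i + 1) * 𝐗⁻ (i + 2) * 𝐞 (i + 1) = lam • 𝐞 (i + 1) := by
  have hi : i < n - 1 := by omega
  have s1 : SemiconjBy (𝐗 (i + 1) * 𝐗 (i + 2) * 𝐗 (i + 1)) (𝐗 (i + 1)) (𝐗 (i + 2)) := by
    change _ * _ = _ * _
    conv_lhs => rw [XX_braid h]
    simp only [mul_assoc]
  have s2 : SemiconjBy (𝐗 (i + 1) * 𝐗 (i + 2) * 𝐗 (i + 1)) (𝐗 (i + 2)) (𝐗 (i + 1)) := by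
    change _ * _ = _ * _
    conv_rhs => rw [XX_braid h]
    simp only [mul_assoc]
  have s3 := (semiconjBy_ee hi h s1).eq
  have s4 := (semiconjBy_inverse s2 (XX_mul_XXi h) (XXi_mul_XX hi)).eq
  set d := 𝐗 (i + 1) * 𝐗 (i + 2) * 𝐗 (i + 1) with hd
  have hinv : 𝐗⁻ (i + 1) * 𝐗⁻ (i + 2) * 𝐗⁻ (i + 1) * d = 1 := by
    calc _ = 𝐗⁻ (i + 1) * (𝐗⁻ (i + 2) * (𝐗⁻ (i + 1) * 𝐗 (i + 1)) * 𝐗 (i + 2)) * 𝐗 (i + 1) := by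
          simp only [hd, mul_assoc]
      _ = 1 := by rw [XXi_mul_XX hi, mul_one, XXi_mul_XX h, mul_one, XXi_mul_XX hi]
  have key : d * (𝐞 (i + 1) * 𝐗⁻ (i + 2) * 𝐞 (i + 1)) = d * (lam • 𝐞 (i + 1)) := by
    rw [← mul_assoc, ← mul_assoc, s3, mul_assoc _ d, s4, ← mul_assoc, mul_assoc _ d, s3,
      ← mul_assoc, ee_XXi_ee h, mul_smul_comm, s3, smul_mul_assoc]
  have := congrArg (𝐗⁻ (i + 1) * 𝐗⁻ (i + 2) * 𝐗⁻ (i + 1) * ·) key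
  simpa only [← mul_assoc _ d, hinv, one_mul] using this

theorem XX_XX_ee_up (hlam : lam * lami = 1) {i : ℕ} (h : i + 1 < n - 1) :
    𝐗 (i + 1) * 𝐗 (i + 2) * 𝐞 (i + 1) = 𝐞 (i + 2) * 𝐞 (i + 1) :=
  mul_mul_idem_eq hlam (XX_mul_XXi h) (semiconjBy_up h) (XX_mul_ee (by omega)) (ee_XXi_ee' h)

theorem XX_XX_ee_down (hlam : lam * lami = 1) {i : ℕ} (h : i + 1 < n - 1) :
    𝐗 (i + 2) * 𝐗 (i + 1) * 𝐞 (i + 2) = 𝐞 (i + 1) * 𝐞 (i + 2) :=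
  mul_mul_idem_eq hlam (XX_mul_XXi (by omega)) (semiconjBy_down h) (XX_mul_ee h) (ee_XXi_ee h)

theorem ee_XX_XX_down (hlam : lam * lami = 1) {i : ℕ} (h : i + 1 < n - 1) :
    𝐞 (i + 1) * 𝐗 (i + 2) * 𝐗 (i + 1) = 𝐞 (i + 1) * 𝐞 (i + 2) := by
  rw [← XX_XX_ee_down hlam h, (semiconjBy_down h).eq, mul_assoc]

theorem ee_mul_XXi (hlam : lam * lami = 1) {i : ℕ} (h : i < n - 1) :
    𝐞 (i + 1) * 𝐗⁻ (i + 1) = lami • 𝐞 (i + 1) := by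
  calc _ = (lami * lam) • 𝐞 (i + 1) * 𝐗⁻ (i + 1) := by rw [mul_comm lami, hlam, one_smul]
    _ = lami • (𝐞 (i + 1) * 𝐗 (i + 1)) * 𝐗⁻ (i + 1) := by rw [ee_mul_XX h, smul_smul]
    _ = _ := by rw [smul_mul_assoc, mul_assoc, XX_mul_XXi h, mul_one]

theorem ee_ee_ee (hlam : lam * lami = 1) {i : ℕ} (h : i + 1 < n - 1) :
    𝐞 (i + 2) * 𝐞 (i + 1) * 𝐞 (i + 2) = 𝐞 (i + 2) := by
  have h1 : 𝐞 (i + 2) * 𝐞 (i + 2) = 𝐞 (i + 2) - deli • (lam • 𝐞 (i + 2) - lami • 𝐞 (i + 2)) := by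
    conv_lhs => rw [ee_def, mul_sub, mul_one, mul_smul_comm, mul_sub, ← ee_def, ee_mul_XX h,
      ee_mul_XXi hlam h]
  have h2 : 𝐞 (i + 2) * 𝐞 (i + 1) * 𝐞 (i + 2) = 𝐞 (i + 2) * 𝐞 (i + 2)
      - deli • (𝐞 (i + 2) * 𝐗 (i + 1) * 𝐞 (i + 2) - 𝐞 (i + 2) * 𝐗⁻ (i + 1) * 𝐞 (i + 2)) := by
    rw [ee_def (i + 1), mul_sub, sub_mul, mul_one, mul_smul_comm,
      smul_mul_assoc, mul_sub, sub_mul]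
  rw [h2, h1, ee_XX_ee h, ee_XXi_ee h]
  module

theorem XX_ee_ee (hlam : lam * lami = 1) {i : ℕ} (h : i + 1 < n - 1) :
    𝐗 (i + 2) * 𝐞 (i + 1) * 𝐞 (i + 2) = 𝐗⁻ (i + 1) * 𝐞 (i + 2) := by
  calc _ = 𝐗⁻ (i + 1) * 𝐗 (i + 1) * 𝐗 (i + 2) * 𝐞 (i + 1) * 𝐞 (i + 2) := by
        rw [XXi_mul_XX (by omega), one_mul]
    _ = 𝐗⁻ (i + 1) * (𝐗 (i + 1) * 𝐗 (i + 2) * 𝐞 (i + 1)) * 𝐞 (i + 2) := by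
        simp only [mul_assoc]
    _ = 𝐗⁻ (i + 1) * (𝐞 (i + 2) * 𝐞 (i + 1) * 𝐞 (i + 2)) := by
        rw [XX_XX_ee_up hlam h]; simp only [mul_assoc]
    _ = _ := by rw [ee_ee_ee hlam h]

theorem ee_ee_XX (hlam : lam * lami = 1) {i : ℕ} (h : i + 1 < n - 1) :
    𝐞 (i + 2) * 𝐞 (i + 1) * 𝐗 (i + 2) = 𝐞 (i + 2) * 𝐗⁻ (i + 1) := by
  calc _ = 𝐞 (i + 2) * 𝐞 (i + 1) * 𝐗 (i + 2) * (𝐗 (i + 1) * 𝐗⁻ (i + 1)) := by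
        rw [XX_mul_XXi (by omega), mul_one]
    _ = 𝐞 (i + 2) * (𝐞 (i + 1) * 𝐗 (i + 2) * 𝐗 (i + 1)) * 𝐗⁻ (i + 1) := by
        simp only [mul_assoc]
    _ = (𝐞 (i + 2) * 𝐞 (i + 1) * 𝐞 (i + 2)) * 𝐗⁻ (i + 1) := by
        rw [ee_XX_XX_down hlam h]; simp only [mul_assoc]
    _ = _ := by rw [ee_ee_ee hlam h]

theorem XX_ee_XX (hlam : lam * lami = 1) {i : ℕ} (h : i + 1 < n - 1) :
    𝐗 (i + 2) * 𝐞 (i + 1) * 𝐗 (i + 2) = 𝐗⁻ (i + 1) * 𝐞 (i + 2) * 𝐗⁻ (i + 1) := by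
  calc _ = 𝐗⁻ (i + 1) * 𝐗 (i + 1) * 𝐗 (i + 2) * 𝐞 (i + 1) * 𝐗 (i + 2) := by
        rw [XXi_mul_XX (by omega), one_mul]
    _ = 𝐗⁻ (i + 1) * (𝐗 (i + 1) * 𝐗 (i + 2) * 𝐞 (i + 1)) * 𝐗 (i + 2) := by
        simp only [mul_assoc]
    _ = 𝐗⁻ (i + 1) * (𝐞 (i + 2) * 𝐞 (i + 1) * 𝐗 (i + 2)) := by
        rw [XX_XX_ee_up hlam h]; simp only [mul_assoc]
    _ = _ := by rw [ee_ee_XX hlam h, mul_assoc]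

theorem XXi_eq {del : R} (hdel : del * deli = 1) (i : ℕ) :
    𝐗⁻ i = 𝐗 i - del • 1 + del • 𝐞 i := by
  rw [ee_def, smul_sub, smul_smul, hdel, one_smul]; abel

theorem XX_mul_self {del : R} (hdel : del * deli = 1) {i : ℕ} (h : i < n - 1) :
    𝐗 (i + 1) * 𝐗 (i + 1) = 1 + del • 𝐗 (i + 1) - (del * lam) • 𝐞 (i + 1) := by
  have h1 := XX_mul_XXi (R := R) (lam := lam) (lami := lami) (deli := deli) (q0 := q0) (q1 := q1)
    (A := A) h
  rw [XXi_eq hdel, mul_add, mul_sub, mul_smul_comm, mul_smul_comm, XX_mul_ee h, mul_one,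
    smul_smul] at h1
  rw [← h1]; abel

theorem Yp_succ (k : ℕ) : 𝐘𝐩 (k + 2) = 𝐗 (k + 1) * 𝐘𝐩 (k + 1) * 𝐗 (k + 1) := rfl

theorem Ypi_succ (k : ℕ) : 𝐘𝐩⁻ (k + 2) = 𝐗⁻ (k + 1) * 𝐘𝐩⁻ (k + 1) * 𝐗⁻ (k + 1) := rfl

theorem Yn_succ (k : ℕ) : 𝐘𝐧 (k + 2) = 𝐗 (k + 1) * 𝐘𝐧 (k + 1) * 𝐗⁻ (k + 1) := rfl

theorem Yp_mul_Ypi {k : ℕ} (h : k < n) : 𝐘𝐩 (k + 1) * 𝐘𝐩⁻ (k + 1) = 1 := by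
  induction k with
  | zero => exact YY_mul_YYi h
  | succ k ih =>
    have hk : k < n - 1 := by omega
    calc 𝐘𝐩 (k + 2) * 𝐘𝐩⁻ (k + 2) = 𝐗 (k + 1) * (𝐘𝐩 (k + 1) * (𝐗 (k + 1) * 𝐗⁻ (k + 1)) *
          𝐘𝐩⁻ (k + 1)) * 𝐗⁻ (k + 1) := by rw [Yp_succ, Ypi_succ]; simp only [mul_assoc]
      _ = 1 := by rw [XX_mul_XXi hk, mul_one, ih (by omega), mul_one, XX_mul_XXi hk]

theorem Ypi_mul_Yp {k : ℕ} (h : k < n) : 𝐘𝐩⁻ (k + 1) * 𝐘𝐩 (k + 1) = 1 := by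
  induction k with
  | zero => exact YYi_mul_YY h
  | succ k ih =>
    have hk : k < n - 1 := by omega
    calc 𝐘𝐩⁻ (k + 2) * 𝐘𝐩 (k + 2) = 𝐗⁻ (k + 1) * (𝐘𝐩⁻ (k + 1) * (𝐗⁻ (k + 1) * 𝐗 (k + 1)) *
          𝐘𝐩 (k + 1)) * 𝐗 (k + 1) := by rw [Yp_succ, Ypi_succ]; simp only [mul_assoc]
      _ = 1 := by rw [XXi_mul_XX hk, mul_one, ih (by omega), mul_one, XXi_mul_XX hk]

theorem Yp_commute_XX_of_lt {k j : ℕ} (hkj : k < j) (h : j < n - 1) :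
    Commute (𝐘𝐩 (k + 1)) (𝐗 (j + 1)) := by
  induction k with
  | zero =>
    obtain ⟨j, rfl⟩ : ∃ i, j = i + 1 := ⟨j - 1, by omega⟩
    exact YY_commute_XX h
  | succ k ih =>
    have hX : Commute (𝐗 (k + 1)) (𝐗 (j + 1)) := (XX_commute h hkj).symm
    exact (hX.mul_left (ih (by omega))).mul_left hX

theorem Yp_commute_XX_of_gt {k j : ℕ} (hjk : j < k) (h : k < n - 1) :
    Commute (𝐘𝐩 (k + 2)) (𝐗 (j + 1)) := by
  induction k with
  | zero => omega
  | succ k ih =>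
    rcases Nat.lt_succ_iff_lt_or_eq.1 hjk with hlt | rfl
    · have hX : Commute (𝐗 (k + 2)) (𝐗 (j + 1)) := XX_commute h (by omega)
      exact (hX.mul_left (ih hlt (by omega))).mul_left hX
    · have hy := (Yp_commute_XX_of_lt (R := R) (lam := lam) (lami := lami) (deli := deli)
        (q0 := q0) (q1 := q1) (A := A) (Nat.lt_succ_self j) h).eq
      have hb := XX_braid (R := R) (lam := lam) (lami := lami) (deli := deli)
        (q0 := q0) (q1 := q1) (A := A) h
      change 𝐗 (j + 2) * (𝐗 (j + 1) * 𝐘𝐩 (j + 1) * 𝐗 (j + 1)) * 𝐗 (j + 2) * 𝐗 (j + 1) =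
        𝐗 (j + 1) * (𝐗 (j + 2) * (𝐗 (j + 1) * 𝐘𝐩 (j + 1) * 𝐗 (j + 1)) * 𝐗 (j + 2))
      calc _ = 𝐗 (j + 2) * 𝐗 (j + 1) * 𝐘𝐩 (j + 1) * (𝐗 (j + 1) * 𝐗 (j + 2) * 𝐗 (j + 1)) := by
            simp only [mul_assoc]
        _ = 𝐗 (j + 2) * 𝐗 (j + 1) * (𝐘𝐩 (j + 1) * 𝐗 (j + 2)) * 𝐗 (j + 1) * 𝐗 (j + 2) := by
            rw [hb]; simp only [mul_assoc]
        _ = (𝐗 (j + 2) * 𝐗 (j + 1) * 𝐗 (j + 2)) * 𝐘𝐩 (j + 1) * 𝐗 (j + 1) * 𝐗 (j + 2) := by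
            rw [hy]; simp only [mul_assoc]
        _ = _ := by rw [← hb]; simp only [mul_assoc]

theorem Yp_commute_YY {k : ℕ} (h : k < n) : Commute (𝐘𝐩 (k + 1)) 𝐘 := by
  induction k with
  | zero => exact Commute.refl _
  | succ k ih =>
    cases k with
    | zero =>
      change 𝐗 1 * 𝐘 * 𝐗 1 * 𝐘 = 𝐘 * (𝐗 1 * 𝐘 * 𝐗 1)
      rw [XYXY (by omega)]; simp only [mul_assoc]
    | succ k =>
      have hX : Commute (𝐗 (k + 2)) 𝐘 := (YY_commute_XX (by omega)).symm
      exact (hX.mul_left (ih (by omega))).mul_left hX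

theorem commute_of_mem_sub {u : 𝐌} {k : ℕ} (hk : k < n) (hY : Commute u 𝐘)
    (hX : ∀ j < k, Commute u (𝐗 (j + 1))) {b : 𝐌} (hb : b ∈ 𝐁 k) : Commute u b := by
  have : 𝐁 k ≤ Subalgebra.centralizer R {u} := by
    refine Algebra.adjoin_le fun a ha => ?_
    rw [SetLike.mem_coe, Subalgebra.mem_centralizer_iff]
    rintro _ rfl
    rcases ha with rfl | rfl | ⟨i, hi, hik, hia⟩
    · exact hY
    · exact commute_YYi (by omega) hY
    · obtain ⟨i, rfl⟩ : ∃ j, i = j + 1 := ⟨i - 1, by omega⟩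
      rcases hia with rfl | rfl
      · exact hX i hik
      · exact commute_XXi (by omega) (hX i hik)
  exact (Subalgebra.mem_centralizer_iff R).1 (this hb) u rfl

theorem Yp_commute_of_mem_sub {k : ℕ} (hk : k < n - 1) {b : 𝐌} (hb : b ∈ 𝐁 k) :
    Commute (𝐘𝐩 (k + 2)) b :=
  commute_of_mem_sub (by omega) (Yp_commute_YY (by omega))
    (fun _ hj => Yp_commute_XX_of_gt hj hk) hb

theorem XX_commute_of_mem_sub {k : ℕ} (hk : k + 1 < n - 1) {b : 𝐌} (hb : b ∈ 𝐁 k) :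
    Commute (𝐗 (k + 2)) b :=
  commute_of_mem_sub (by omega) (YY_commute_XX hk).symm
    (fun _ hj => XX_commute hk (by omega)) hb

theorem YY_mem_sub (k : ℕ) : 𝐘 ∈ 𝐁 k := Algebra.subset_adjoin (.inl rfl)

theorem YYi_mem_sub (k : ℕ) : 𝐘⁻ ∈ 𝐁 k := Algebra.subset_adjoin (.inr (.inl rfl))

theorem XX_mem_sub {j k : ℕ} (h : j < k) : 𝐗 (j + 1) ∈ 𝐁 k :=
  Algebra.subset_adjoin (.inr (.inr ⟨j + 1, by omega, h, .inl rfl⟩))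

theorem XXi_mem_sub {j k : ℕ} (h : j < k) : 𝐗⁻ (j + 1) ∈ 𝐁 k :=
  Algebra.subset_adjoin (.inr (.inr ⟨j + 1, by omega, h, .inr rfl⟩))

theorem ee_mem_sub {j k : ℕ} (h : j < k) : 𝐞 (j + 1) ∈ 𝐁 k :=
  (𝐁 k).sub_mem (𝐁 k).one_mem
    ((𝐁 k).smul_mem ((𝐁 k).sub_mem (XX_mem_sub h) (XXi_mem_sub h)) _)

theorem Yp_mem_sub {j k : ℕ} (h : j ≤ k) : 𝐘𝐩 (j + 1) ∈ 𝐁 k := by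
  induction j with
  | zero => exact YY_mem_sub k
  | succ j ih =>
    exact (𝐁 k).mul_mem ((𝐁 k).mul_mem (XX_mem_sub h) (ih (by omega))) (XX_mem_sub h)

theorem Ypi_mem_sub {j k : ℕ} (h : j ≤ k) : 𝐘𝐩⁻ (j + 1) ∈ 𝐁 k := by
  induction j with
  | zero => exact YYi_mem_sub k
  | succ j ih =>
    exact (𝐁 k).mul_mem ((𝐁 k).mul_mem (XXi_mem_sub h) (ih (by omega))) (XXi_mem_sub h)

theorem Yn_mem_sub {j k : ℕ} (h : j ≤ k) : 𝐘𝐧 (j + 1) ∈ 𝐁 k := by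
  induction j with
  | zero => exact YY_mem_sub k
  | succ j ih =>
    exact (𝐁 k).mul_mem ((𝐁 k).mul_mem (XX_mem_sub h) (ih (by omega))) (XXi_mem_sub h)

theorem sub_mono {j k : ℕ} (h : j ≤ k) : 𝐁 j ≤ 𝐁 k := by
  refine Algebra.adjoin_mono ?_
  rintro a (ha | ha | ⟨i, hi, hij, hia⟩)
  exacts [.inl ha, .inr (.inl ha), .inr (.inr ⟨i, hi, hij.trans h, hia⟩)]

theorem Yp_XX_Yp_ee (hlam : lam * lami = 1) {k : ℕ} (h : k < n - 1) :
    𝐘𝐩 (k + 1) * 𝐗 (k + 1) * 𝐘𝐩 (k + 1) * 𝐞 (k + 1) = 𝐞 (k + 1) := by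
  induction k with
  | zero => exact YXY_ee h
  | succ k ih =>
    have hk : k < n - 1 := by omega
    have hy := (Yp_commute_XX_of_lt (R := R) (lam := lam) (lami := lami) (deli := deli)
      (q0 := q0) (q1 := q1) (A := A) (Nat.lt_succ_self k) h).eq
    have hb := XX_braid (R := R) (lam := lam) (lami := lami) (deli := deli)
      (q0 := q0) (q1 := q1) (A := A) h
    have h1 := XX_XX_ee_up (R := R) (deli := deli) (q0 := q0) (q1 := q1) (A := A) hlam h
    have h2 := XX_XX_ee_down (R := R) (deli := deli) (q0 := q0) (q1 := q1) (A := A) hlam h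
    change 𝐘𝐩 (k + 2) * 𝐗 (k + 2) * 𝐘𝐩 (k + 2) * 𝐞 (k + 2) = 𝐞 (k + 2)
    rw [Yp_succ]
    set a := 𝐗 (k + 1)
    set b := 𝐗 (k + 2)
    set y := 𝐘𝐩 (k + 1)
    set e := 𝐞 (k + 1)
    set f := 𝐞 (k + 2)
    calc a * y * a * b * (a * y * a) * f = a * y * (a * b * a) * y * a * f := by
          simp only [mul_assoc]
      _ = a * (y * b) * a * (b * y) * a * f := by rw [hb]; simp only [mul_assoc]
      _ = a * (b * y) * a * (y * b) * a * f := by rw [hy]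
      _ = a * b * y * a * y * (b * a * f) := by simp only [mul_assoc]
      _ = a * b * (y * a * y * e) * f := by rw [h2]; simp only [mul_assoc]
      _ = a * b * e * f := by rw [ih hk]
      _ = f := by rw [h1, ee_ee_ee hlam h]

theorem ee_Yp_XX_Yp (hlam : lam * lami = 1) {k : ℕ} (h : k < n - 1) :
    𝐞 (k + 1) * 𝐘𝐩 (k + 1) * 𝐗 (k + 1) * 𝐘𝐩 (k + 1) = 𝐞 (k + 1) := by
  have hc : Commute (𝐘𝐩 (k + 1) * 𝐗 (k + 1) * 𝐘𝐩 (k + 1)) (𝐗 (k + 1)) := by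
    have h1 := Yp_commute_of_mem_sub h (Yp_mem_sub (R := R) (lam := lam) (lami := lami)
      (deli := deli) (q0 := q0) (q1 := q1) (A := A) (le_refl k))
    have h2 := h1.eq
    rw [Yp_succ] at h2
    change _ * _ = _ * _
    calc _ = 𝐘𝐩 (k + 1) * (𝐗 (k + 1) * 𝐘𝐩 (k + 1) * 𝐗 (k + 1)) := by simp only [mul_assoc]
      _ = _ := by rw [← h2]; simp only [mul_assoc]
  have := (commute_ee h hc).eq
  rw [Yp_XX_Yp_ee hlam h] at this
  simpa only [mul_assoc] using this.symm

theorem XX_Yp_ee (hlam : lam * lami = 1) {k : ℕ} (h : k < n - 1) :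
    𝐗 (k + 1) * 𝐘𝐩 (k + 1) * 𝐞 (k + 1) = 𝐘𝐩⁻ (k + 1) * 𝐞 (k + 1) := by
  conv_rhs => rw [← Yp_XX_Yp_ee hlam h]
  simp only [← mul_assoc]
  rw [Ypi_mul_Yp (by omega), one_mul]

theorem ee_Yp_XX (hlam : lam * lami = 1) {k : ℕ} (h : k < n - 1) :
    𝐞 (k + 1) * 𝐘𝐩 (k + 1) * 𝐗 (k + 1) = 𝐞 (k + 1) * 𝐘𝐩⁻ (k + 1) := by
  conv_rhs => rw [← ee_Yp_XX_Yp hlam h]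
  rw [mul_assoc _ (𝐘𝐩 (k + 1)) (𝐘𝐩⁻ (k + 1)), Yp_mul_Ypi (by omega), mul_one]

local notation "𝐒₀" k:max => bimoduleSpan (𝐁 k) ({1, 𝐞 (k + 1), 𝐗 (k + 1)} : Set 𝐌)
local notation "𝐒" k:max => bimoduleSpan (𝐁 k) ({1, 𝐞 (k + 1), 𝐗 (k + 1), 𝐘𝐩 (k + 2)} : Set 𝐌)

theorem bimoduleSpan_three_le (k : ℕ) : 𝐒₀ k ≤ 𝐒 k :=
  bimoduleSpan_le fun g hg => subset_bimoduleSpan (by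
    rcases hg with rfl | rfl | rfl <;> simp)

theorem XX_mul_mul_mem {k : ℕ} {C : Subalgebra R 𝐌} {D G : Set 𝐌} {t : 𝐌} (hC : C ≤ 𝐁 k)
    (hX : ∀ c ∈ C, Commute (𝐗 (k + 1)) c) (ht : ∀ c ∈ C, Commute t c)
    (hD : ∀ d ∈ D, 𝐗 (k + 1) * d * t ∈ bimoduleSpan (𝐁 k) G) {s : 𝐌}
    (hs : s ∈ bimoduleSpan C D) : 𝐗 (k + 1) * s * t ∈ bimoduleSpan (𝐁 k) G := by
  refine map_mem_of_mem_bimoduleSpan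
    ((LinearMap.mulRight R t).comp (LinearMap.mulLeft R (𝐗 (k + 1)))) _ ?_ hs
  intro c hc c' hc' d hd
  have h : 𝐗 (k + 1) * (c * d * c') * t = c * (𝐗 (k + 1) * d * t) * c' := by
    calc _ = (𝐗 (k + 1) * c) * d * (c' * t) := by simp only [mul_assoc]
      _ = _ := by rw [(hX c hc).eq, ← (ht c' hc').eq]; simp only [mul_assoc]
  simpa [h] using bimoduleSpan_mul_mem (hC hc') (mul_mem_bimoduleSpan (hC hc) (hD d hd))

theorem mem_bimoduleSpan_of_mem_sub_zero {q0i : R} (hq0 : q0 * q0i = 1) (hn : 0 < n) {b : 𝐌}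
    (hb : b ∈ 𝐁 0) : b ∈ bimoduleSpan (⊥ : Subalgebra R 𝐌) ({1, 𝐘} : Set 𝐌) := by
  have h_one : (1 : 𝐌) ∈ bimoduleSpan (⊥ : Subalgebra R 𝐌) ({1, 𝐘} : Set 𝐌) :=
    subset_bimoduleSpan (by simp)
  have h_Y : 𝐘 ∈ bimoduleSpan (⊥ : Subalgebra R 𝐌) ({1, 𝐘} : Set 𝐌) :=
    subset_bimoduleSpan (by simp)
  have hY : ∀ s ∈ bimoduleSpan (⊥ : Subalgebra R 𝐌) ({1, 𝐘} : Set 𝐌),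
      𝐘 * s ∈ bimoduleSpan (⊥ : Subalgebra R 𝐌) ({1, 𝐘} : Set 𝐌) := by
    intro s hs
    refine map_mem_of_mem_bimoduleSpan (LinearMap.mulLeft R 𝐘) _ ?_ hs
    rintro _ hw w2 h2 g hg
    obtain ⟨r, rfl⟩ := Algebra.mem_bot.1 hw
    rw [LinearMap.mulLeft_apply, ← mul_assoc, ← mul_assoc, ← Algebra.commutes r 𝐘,
      mul_assoc _ 𝐘 g]
    refine bimoduleSpan_mul_mem h2 (mul_mem_bimoduleSpan hw ?_)
    rcases hg with rfl | rfl
    · rwa [mul_one]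
    · rw [YY_sq hn]
      exact Submodule.add_mem _ (Submodule.smul_mem _ _ h_Y) (Submodule.smul_mem _ _ h_one)
  have hYi : 𝐘⁻ = q0i • (𝐘 - q1 • 1) := by
    have h1 : 𝐘 * 𝐘 * 𝐘⁻ = q1 • 1 + q0 • 𝐘⁻ := by
      rw [YY_sq hn, add_mul, smul_mul_assoc, smul_mul_assoc, YY_mul_YYi hn, one_mul]
    rw [mul_assoc, YY_mul_YYi hn, mul_one] at h1
    rw [h1, add_sub_cancel_left, smul_smul, mul_comm, hq0, one_smul]
  refine adjoin_le_of_mul_mem h_one ?_ hb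
  rintro g (rfl | rfl | ⟨i, hi, hi', _⟩) s hs
  · exact hY s hs
  · rw [hYi, smul_mul_assoc, sub_mul, smul_mul_assoc, one_mul]
    exact Submodule.smul_mem _ _ (Submodule.sub_mem _ (hY s hs) (Submodule.smul_mem _ _ hs))
  · omega

/-- If `X b e` and `X b X` are linear combinations of normal words for all `b` in the smaller
algebra, then so is every element of the next one. -/
theorem mem_bimoduleSpan_of_mem_sub_succ {del : R} (hlam : lam * lami = 1) (hdel : del * deli = 1)
    {k : ℕ} (h : k < n - 1) (he : ∀ b ∈ 𝐁 k, 𝐗 (k + 1) * b * 𝐞 (k + 1) ∈ 𝐒₀ k)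
    (hX : ∀ b ∈ 𝐁 k, 𝐗 (k + 1) * b * 𝐗 (k + 1) ∈ 𝐒 k) {b : 𝐌} (hb : b ∈ 𝐁 (k + 1)) :
    b ∈ 𝐒 k := by
  have h_one : (1 : 𝐌) ∈ 𝐒 k := subset_bimoduleSpan (by simp)
  have h_e : 𝐞 (k + 1) ∈ 𝐒 k := subset_bimoduleSpan (by simp)
  have h_X : 𝐗 (k + 1) ∈ 𝐒 k := subset_bimoduleSpan (by simp)
  have h_z : 𝐘𝐩 (k + 2) ∈ 𝐒 k := subset_bimoduleSpan (by simp)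
  have XS : ∀ s ∈ 𝐒 k, 𝐗 (k + 1) * s ∈ 𝐒 k := by
    intro s hs
    refine map_mem_of_mem_bimoduleSpan (LinearMap.mulLeft R (𝐗 (k + 1))) _ ?_ hs
    rintro w1 h1 w2 h2 g hg
    rw [LinearMap.mulLeft_apply, ← mul_assoc]
    refine bimoduleSpan_mul_mem h2 ?_
    rcases hg with rfl | rfl | rfl | rfl
    · rw [mul_one]
      exact bimoduleSpan_mul_mem h1 h_X
    · rw [← mul_assoc]
      exact bimoduleSpan_three_le k (he w1 h1)
    · rw [← mul_assoc]
      exact hX w1 h1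
    · rw [← (Yp_commute_of_mem_sub h h1).eq, ← mul_assoc]
      refine bimoduleSpan_mul_mem h1 ?_
      have hz : 𝐗 (k + 1) * 𝐘𝐩 (k + 2) = 𝐘𝐩 (k + 1) * 𝐗 (k + 1) + del • 𝐘𝐩 (k + 2) -
          (del * lam) • (𝐞 (k + 1) * 𝐘𝐩⁻ (k + 1)) := by
        rw [← ee_Yp_XX hlam h, Yp_succ, mul_assoc (𝐗 (k + 1)), ← mul_assoc (𝐗 (k + 1)),
          XX_mul_self hdel h]
        simp only [add_mul, sub_mul, smul_mul_assoc, one_mul, mul_assoc]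
      rw [hz]
      exact Submodule.sub_mem _ (Submodule.add_mem _
        (mul_mem_bimoduleSpan (Yp_mem_sub le_rfl) h_X) (Submodule.smul_mem _ _ h_z))
        (Submodule.smul_mem _ _ (bimoduleSpan_mul_mem (Ypi_mem_sub le_rfl) h_e))
  have eS : ∀ s ∈ 𝐒 k, 𝐞 (k + 1) * s ∈ 𝐒 k := by
    intro s hs
    have h1 : 𝐞 (k + 1) * s = (lami * deli) • (s + del • (𝐗 (k + 1) * s) -
        𝐗 (k + 1) * (𝐗 (k + 1) * s)) := by
      have h2 : lami * deli * (del * lam) = 1 := by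
        linear_combination hdel + del * deli * hlam
      rw [← mul_assoc, XX_mul_self hdel h, sub_mul, add_mul, one_mul, smul_mul_assoc,
        smul_mul_assoc, sub_sub_cancel, smul_smul, h2, one_smul]
    rw [h1]
    exact Submodule.smul_mem _ _ (Submodule.sub_mem _ (Submodule.add_mem _ hs
      (Submodule.smul_mem _ _ (XS s hs))) (XS _ (XS s hs)))
  refine adjoin_le_of_mul_mem h_one ?_ hb
  rintro g (rfl | rfl | ⟨i, hi, hik, hg⟩) s hs
  · exact mul_mem_bimoduleSpan (YY_mem_sub k) hs
  · exact mul_mem_bimoduleSpan (YYi_mem_sub k) hs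
  · obtain ⟨i, rfl⟩ : ∃ j, i = j + 1 := ⟨i - 1, by omega⟩
    rcases Nat.lt_succ_iff_lt_or_eq.1 hik with hlt | heq
    · rcases hg with rfl | rfl
      · exact mul_mem_bimoduleSpan (XX_mem_sub (by omega)) hs
      · exact mul_mem_bimoduleSpan (XXi_mem_sub (by omega)) hs
    · obtain rfl : i = k := by omega
      rcases hg with rfl | rfl
      · exact XS s hs
      · rw [XXi_eq hdel, add_mul, sub_mul, smul_mul_assoc, smul_mul_assoc, one_mul]
        exact Submodule.add_mem _ (Submodule.sub_mem _ (XS s hs) (Submodule.smul_mem _ _ hs))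
          (Submodule.smul_mem _ _ (eS s hs))

theorem XX_mul_self_mem {del : R} (hdel : del * deli = 1) {k : ℕ} (h : k < n - 1) :
    𝐗 (k + 1) * 𝐗 (k + 1) ∈ 𝐒₀ k := by
  rw [XX_mul_self hdel h]
  exact Submodule.sub_mem _ (Submodule.add_mem _ (subset_bimoduleSpan (by simp))
    (Submodule.smul_mem _ _ (subset_bimoduleSpan (by simp))))
    (Submodule.smul_mem _ _ (subset_bimoduleSpan (by simp)))

theorem XX_mul_mul_XX_mem {del : R} (hlam : lam * lami = 1) (hdel : del * deli = 1) {k : ℕ}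
    (h : k + 1 < n - 1) {d : 𝐌} (hd : d ∈ ({1, 𝐞 (k + 1), 𝐗 (k + 1)} : Set 𝐌)) :
    𝐗 (k + 2) * d * 𝐗 (k + 2) ∈ 𝐒₀ (k + 1) := by
  rcases hd with rfl | rfl | rfl
  · rw [mul_one]
    exact XX_mul_self_mem hdel h
  · rw [XX_ee_XX hlam h]
    exact mul_mul_mem_bimoduleSpan (XXi_mem_sub (by omega)) (by simp) (XXi_mem_sub (by omega))
  · rw [← XX_braid h]
    exact mul_mul_mem_bimoduleSpan (XX_mem_sub (by omega)) (by simp) (XX_mem_sub (by omega))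

theorem XX_mul_mul_XX_mem_of_mem {del : R} (hlam : lam * lami = 1) (hdel : del * deli = 1) {k : ℕ}
    (h : k + 1 < n - 1) {s : 𝐌} (hs : s ∈ 𝐒₀ k) : 𝐗 (k + 2) * s * 𝐗 (k + 2) ∈ 𝐒₀ (k + 1) :=
  XX_mul_mul_mem (sub_mono (by omega)) (fun _ hc => XX_commute_of_mem_sub h hc)
    (fun _ hc => XX_commute_of_mem_sub h hc)
    (fun _ hd => XX_mul_mul_XX_mem hlam hdel h hd) hs

theorem XX_Yp_ee_mem (hlam : lam * lami = 1) {k : ℕ} (h : k < n - 1) :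
    𝐗 (k + 1) * 𝐘𝐩 (k + 1) * 𝐞 (k + 1) ∈ 𝐒₀ k := by
  rw [XX_Yp_ee hlam h]
  exact mul_mem_bimoduleSpan (Ypi_mem_sub le_rfl) (subset_bimoduleSpan (by simp))

theorem XX_ee_mem {k : ℕ} (h : k < n - 1) : 𝐗 (k + 1) * 1 * 𝐞 (k + 1) ∈ 𝐒₀ k := by
  rw [mul_one, XX_mul_ee h]
  exact Submodule.smul_mem _ _ (subset_bimoduleSpan (by simp))

theorem mem_bimoduleSpan_and_XX_mul_mul_ee_mem {del q0i : R} (hlam : lam * lami = 1)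
    (hdel : del * deli = 1) (hq0 : q0 * q0i = 1) {k : ℕ} (h : k < n - 1) :
    (∀ b ∈ 𝐁 (k + 1), b ∈ 𝐒 k) ∧ ∀ b ∈ 𝐁 k, 𝐗 (k + 1) * b * 𝐞 (k + 1) ∈ 𝐒₀ k := by
  induction k with
  | zero =>
    have hbot : ∀ u : 𝐌, ∀ c ∈ (⊥ : Subalgebra R 𝐌), Commute u c := by
      rintro u _ hc
      obtain ⟨r, rfl⟩ := Algebra.mem_bot.1 hc
      exact (Algebra.commutes r u).symm
    have he : ∀ b ∈ 𝐁 0, 𝐗 (0 + 1) * b * 𝐞 (0 + 1) ∈ 𝐒₀ 0 := fun b hb => by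
      refine XX_mul_mul_mem bot_le (hbot _) (hbot _) ?_
        (mem_bimoduleSpan_of_mem_sub_zero hq0 (by omega) hb)
      rintro d (rfl | rfl)
      · exact XX_ee_mem h
      · exact XX_Yp_ee_mem hlam h
    refine ⟨fun b hb => mem_bimoduleSpan_of_mem_sub_succ hlam hdel h he (fun b hb => ?_) hb, he⟩
    refine XX_mul_mul_mem bot_le (hbot _) (hbot _) ?_
      (mem_bimoduleSpan_of_mem_sub_zero hq0 (by omega) hb)
    rintro d (rfl | rfl)
    · rw [mul_one]
      exact bimoduleSpan_three_le _ (XX_mul_self_mem hdel h)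
    · exact subset_bimoduleSpan (.inr (.inr (.inr rfl)))
  | succ k ih =>
    obtain ⟨ih, -⟩ := ih (by omega)
    have hc : ∀ c ∈ 𝐁 k, Commute (𝐗 (k + 2)) c := fun c hc => XX_commute_of_mem_sub h hc
    have hec : ∀ c ∈ 𝐁 k, Commute (𝐞 (k + 2)) c := fun c hk =>
      (commute_ee h (hc c hk).symm).symm
    have he : ∀ b ∈ 𝐁 (k + 1), 𝐗 (k + 2) * b * 𝐞 (k + 2) ∈ 𝐒₀ (k + 1) := fun b hb => by
      refine XX_mul_mul_mem (sub_mono (by omega)) hc hec ?_ (ih b hb)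
      rintro d (rfl | rfl | rfl | rfl)
      · exact XX_ee_mem h
      · rw [XX_ee_ee hlam h]
        exact mul_mem_bimoduleSpan (XXi_mem_sub (by omega)) (subset_bimoduleSpan (by simp))
      · rw [XX_XX_ee_down hlam h]
        exact mul_mem_bimoduleSpan (ee_mem_sub (by omega)) (subset_bimoduleSpan (by simp))
      · exact XX_Yp_ee_mem hlam h
    refine ⟨fun b hb => mem_bimoduleSpan_of_mem_sub_succ hlam hdel h he (fun b hb => ?_) hb, he⟩
    refine XX_mul_mul_mem (sub_mono (by omega)) hc hc ?_ (ih b hb)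
    rintro d (rfl | rfl | rfl | rfl)
    · exact bimoduleSpan_three_le _ (XX_mul_mul_XX_mem hlam hdel h (by simp))
    · exact bimoduleSpan_three_le _ (XX_mul_mul_XX_mem hlam hdel h (by simp))
    · exact bimoduleSpan_three_le _ (XX_mul_mul_XX_mem hlam hdel h (by simp))
    · exact subset_bimoduleSpan (.inr (.inr (.inr rfl)))

theorem Yn_sub_Yp_mem {del q0i : R} (hlam : lam * lami = 1) (hdel : del * deli = 1)
    (hq0 : q0 * q0i = 1) {k : ℕ} (h : k < n - 1) : 𝐘𝐧 (k + 2) - 𝐘𝐩 (k + 2) ∈ 𝐒₀ k := by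
  have step : ∀ k < n - 1, 𝐗 (k + 1) * (𝐘𝐧 (k + 1) - 𝐘𝐩 (k + 1)) * 𝐗 (k + 1) ∈ 𝐒₀ k →
      𝐘𝐧 (k + 2) - 𝐘𝐩 (k + 2) ∈ 𝐒₀ k := by
    intro k h hs
    have key : 𝐘𝐧 (k + 2) - 𝐘𝐩 (k + 2) =
        𝐗 (k + 1) * (𝐘𝐧 (k + 1) - 𝐘𝐩 (k + 1)) * 𝐗 (k + 1) - del • (𝐗 (k + 1) * 𝐘𝐧 (k + 1)) +
          del • (𝐗 (k + 1) * 𝐘𝐧 (k + 1) * 𝐞 (k + 1)) := by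
      rw [Yn_succ, Yp_succ, XXi_eq hdel, mul_add, mul_sub, mul_smul_comm, mul_smul_comm, mul_one,
        mul_sub, sub_mul]
      abel
    rw [key]
    exact Submodule.add_mem _ (Submodule.sub_mem _ hs (Submodule.smul_mem _ _
      (bimoduleSpan_mul_mem (Yn_mem_sub le_rfl) (subset_bimoduleSpan (by simp)))))
      (Submodule.smul_mem _ _
        ((mem_bimoduleSpan_and_XX_mul_mul_ee_mem hlam hdel hq0 h).2 _ (Yn_mem_sub le_rfl)))
  induction k with
  | zero =>
    refine step 0 h ?_
    have : 𝐘𝐧 (0 + 1) - 𝐘𝐩 (0 + 1) = 0 := sub_self 𝐘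
    rw [this, mul_zero, zero_mul]
    exact Submodule.zero_mem _
  | succ k ih => exact step (k + 1) h (XX_mul_mul_XX_mem_of_mem hlam hdel h (ih (by omega)))

theorem sub_eq_top : 𝐁 (n - 1) = ⊤ := by
  have hsurj : Function.Surjective (mk R lam lami deli q0 q1 A n) :=
    RingQuot.mkAlgHom_surjective R _
  rw [eq_top_iff, ← (AlgHom.range_eq_top _).2 hsurj, ← Algebra.map_top,
    ← FreeAlgebra.adjoin_range_ι, AlgHom.map_adjoin]
  refine Algebra.adjoin_mono ?_
  rintro _ ⟨_, ⟨g, rfl⟩, rfl⟩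
  cases g with
  | X i => exact .inr (.inr ⟨i + 1, by omega, i.2, .inl (XX_succ i.2).symm⟩)
  | Xinv i => exact .inr (.inr ⟨i + 1, by omega, i.2, .inr (XXi_succ i.2).symm⟩)
  | Y h => exact .inl (YY_eq h).symm
  | Yinv h => exact .inr (.inl (YYi_eq h).symm)

end Relations

/-- Proposition 7 (normal form): every element of `BB_n(R)` is a linear combination of words
`w₁ γ w₂` with `w₁, w₂` in the image of `BB_{n-1}(R)` and `γ ∈ {1, e_{n−1}, X_{n−1}, Y_n}`. -/
theorem BB_normal_form_Yn (R : Type) [CommRing R] [IsDomain R]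
    (q qi lam lami del deli q0 q0i q1 A x : R)
    (hq : q * qi = 1) (hlam : lam * lami = 1) (hdel : del * deli = 1) (hq0u : q0 * q0i = 1)
    (hdelta : del = q - qi) (hx : x * del = del - lam + lami)
    (hA : A * (1 - q0 * lam) = q1 * x) (hq0 : q0 = qi) (n : ℕ) (hn : 2 ≤ n) :
    Submodule.span R {w : BB R lam lami deli q0 q1 A n | ∃ w1 ∈ sub R lam lami deli q0 q1 A n (n - 2), ∃ w2 ∈ sub R lam lami deli q0 q1 A n (n - 2),
      ∃ γ ∈ ({1, ee R lam lami deli q0 q1 A n (n - 1), XX R lam lami deli q0 q1 A n (n - 1), Yn R lam lami deli q0 q1 A n n} : Set (BB R lam lami deli q0 q1 A n)),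
      w = w1 * γ * w2} = ⊤ := by
  obtain ⟨k, rfl⟩ : ∃ k, n = k + 2 := ⟨n - 2, by omega⟩
  have h : k < k + 2 - 1 := by omega
  change bimoduleSpan (sub R lam lami deli q0 q1 A (k + 2) k)
    {1, ee R lam lami deli q0 q1 A (k + 2) (k + 1), XX R lam lami deli q0 q1 A (k + 2) (k + 1),
      Yn R lam lami deli q0 q1 A (k + 2) (k + 2)} = ⊤
  refine eq_top_iff.2 fun b _ => ?_
  have hb : b ∈ sub R lam lami deli q0 q1 A (k + 2) (k + 1) := by
    have htop := sub_eq_top (R := R) (lam := lam) (lami := lami) (deli := deli) (q0 := q0)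
      (q1 := q1) (A := A) (n := k + 2)
    exact htop.symm ▸ Algebra.mem_top
  refine bimoduleSpan_le ?_ ((mem_bimoduleSpan_and_XX_mul_mul_ee_mem hlam hdel hq0u h).1 b hb)
  rintro g (rfl | rfl | rfl | rfl)
  · exact subset_bimoduleSpan (by simp)
  · exact subset_bimoduleSpan (by simp)
  · exact subset_bimoduleSpan (by simp)
  · have hY : Yn R lam lami deli q0 q1 A (k + 2) (k + 2) ∈
        bimoduleSpan (sub R lam lami deli q0 q1 A (k + 2) k)
          {1, ee R lam lami deli q0 q1 A (k + 2) (k + 1),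
            XX R lam lami deli q0 q1 A (k + 2) (k + 1),
            Yn R lam lami deli q0 q1 A (k + 2) (k + 2)} := subset_bimoduleSpan (by simp)
    rw [← sub_sub_cancel (Yn R lam lami deli q0 q1 A (k + 2) (k + 2)) (Yp R _ _ _ _ _ _ _ _)]
    refine Submodule.sub_mem _ hY (bimoduleSpan_le ?_ (Yn_sub_Yp_mem hlam hdel hq0u h))
    rintro g (rfl | rfl | rfl) <;> exact subset_bimoduleSpan (by simp)

end BMWB
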